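/- Vanishing of the exponential-field J functions at the free-fermion-like point a = −1/2 for an odd number of particles: for every odd N ≥ 1 and every admissible tuple X = (x_1,…,x_N), J_{N,−1/2}(X) = 0 (here e^{iπa} = −i at a = −1/2). This follows from the reflection property J_{N,a} = J_{N,−a} combined with the periodicity J_{N,a+1} = (−1)^N J_{N,a}. -/

import Mathlib

open Finset Filter Complex

/-- The function `f(x) = (x+ω)(x−ω⁻¹)/(x²−1)`. -/
noncomputable def ff (ω x : ℂ) : ℂ := (x + ω) * (x - ω⁻¹) / (x ^ 2 - 1)

/-- The power sum `S_m` (with `m ∈ ℤ`) of the entries `X i`, `i ∈ I`. -/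
noncomputable def pS (m : ℤ) {N : ℕ} (X : Fin N → ℂ) (I : Finset (Fin N)) : ℂ :=
  ∑ i ∈ I, X i ^ m

/-- The polynomial `P^h(X_-|X_+) = ∏_{m=1}^s (S_m(X_-) − (−1)^m S_m(X_+))^{k_m}` of the
partition `h` with multiplicities `k` (with `k m` parts equal to `m`, `1 ≤ m ≤ s`),
evaluated on the entries of `X` indexed by `Im` and `Ip`. -/
noncomputable def Ph (k : ℕ → ℕ) (s : ℕ) {N : ℕ} (X : Fin N → ℂ)
    (Im Ip : Finset (Fin N)) : ℂ :=
  ∏ m ∈ Finset.Icc 1 s, (pS (m : ℤ) X Im - (-1 : ℂ) ^ m * pS (m : ℤ) X Ip) ^ k m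

/-- A tuple is admissible if all entries are nonzero and `x_i ≠ ±x_j` for `i ≠ j`. -/
def Admissible {N : ℕ} (X : Fin N → ℂ) : Prop :=
  (∀ i, X i ≠ 0) ∧ ∀ i j, i ≠ j → X i ≠ X j ∧ X i ≠ -X j

/-- The phase factor `e^{iπa(#I_- − #I_+)}` where `#I_- = c`, `#I_+ = N − c`. -/
noncomputable def phase (a : ℂ) (N c : ℕ) : ℂ :=
  Complex.exp (Complex.I * (Real.pi : ℂ) * a * (2 * (c : ℂ) - (N : ℂ)))

/-- The descendant function
`J^h_{N,a}(X) = Σ_{I_- ⊔ I_+} e^{iπa(#I_- − #I_+)} P^h(X_-|X_+) ∏_{i∈I_-, j∈I_+} f(x_i/x_j)`. -/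
noncomputable def J (ω : ℂ) (k : ℕ → ℕ) (s : ℕ) (a : ℂ) {N : ℕ} (X : Fin N → ℂ) : ℂ :=
  ∑ I : Finset (Fin N),
    phase a N I.card * Ph k s X I Iᶜ * ∏ i ∈ I, ∏ j ∈ Iᶜ, ff ω (X i / X j)

/-- The exponential-field function `J_{N,a}(X)` (the case `P^h = 1`). -/
noncomputable def Jexp (ω a : ℂ) {N : ℕ} (X : Fin N → ℂ) : ℂ :=
  ∑ I : Finset (Fin N),
    phase a N I.card * ∏ i ∈ I, ∏ j ∈ Iᶜ, ff ω (X i / X j)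

section AlternatingCutSum

variable {F ι : Type*} [Field F]

/-- The weight `1 + s x_i x_j / (x_i² - x_j²)` of an ordered pair of indices. -/
def pairWeight (s : F) (x : ι → F) (i j : ι) : F :=
  1 + s * x i * x j / (x i ^ 2 - x j ^ 2)

lemma pairWeight_mul_left (s : F) (x : ι → F) {i j : ι} (h : x i ^ 2 ≠ x j ^ 2) :
    pairWeight s x i j * (x j ^ 2 - x i ^ 2) = x j ^ 2 - s * x i * x j - x i ^ 2 := by
  have h' := sub_ne_zero.2 h
  simp only [pairWeight]
  field_simp
  ring

lemma pairWeight_mul_right (s : F) (x : ι → F) {i j : ι} (h : x i ^ 2 ≠ x j ^ 2) :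
    pairWeight s x i j * (x i ^ 2 - x j ^ 2) = x i ^ 2 + s * x j * x i - x j ^ 2 := by
  have h' := sub_ne_zero.2 h
  simp only [pairWeight]
  field_simp
  ring

lemma prod_pairWeight_mul_left (s : F) (x : ι → F) {T : Finset ι} {a : ι}
    (h : ∀ i ∈ T, x i ^ 2 ≠ x a ^ 2) :
    (∏ i ∈ T, pairWeight s x i a) * ∏ i ∈ T, (x a ^ 2 - x i ^ 2) =
      ∏ i ∈ T, (x a ^ 2 - s * x i * x a - x i ^ 2) := by
  rw [← Finset.prod_mul_distrib]
  exact Finset.prod_congr rfl fun i hi => pairWeight_mul_left s x (h i hi)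

lemma prod_pairWeight_mul_right (s : F) (x : ι → F) {T : Finset ι} {a : ι}
    (h : ∀ i ∈ T, x i ^ 2 ≠ x a ^ 2) :
    (∏ i ∈ T, pairWeight s x a i) * ∏ i ∈ T, (x a ^ 2 - x i ^ 2) =
      ∏ i ∈ T, (x a ^ 2 + s * x i * x a - x i ^ 2) := by
  rw [← Finset.prod_mul_distrib]
  exact Finset.prod_congr rfl fun i hi => pairWeight_mul_right s x (h i hi).symm

variable [DecidableEq ι]

/-- The product of the pair weights over all pairs leading from `K` to `S \ K`. -/
def cutWeight (s : F) (x : ι → F) (S K : Finset ι) : F :=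
  ∏ i ∈ K, ∏ j ∈ S \ K, pairWeight s x i j

/-- The alternating sum of the cut weights over all subsets of `S`. -/
def altCutSum (s : F) (x : ι → F) (S : Finset ι) : F :=
  ∑ K ∈ S.powerset, (-1) ^ K.card * cutWeight s x S K

lemma cutWeight_insert_left (s : F) (x : ι → F) {S K : Finset ι} {a : ι} (ha : a ∉ S)
    (hK : K ⊆ S) :
    cutWeight s x (insert a S) K = cutWeight s x S K * ∏ i ∈ K, pairWeight s x i a := by
  have haK : a ∉ K := fun h => ha (hK h)
  have haS : a ∉ S \ K := fun h => ha (Finset.mem_sdiff.1 h).1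
  simp only [cutWeight]
  rw [Finset.insert_sdiff_of_notMem _ haK, ← Finset.prod_mul_distrib]
  refine Finset.prod_congr rfl fun i _ => ?_
  rw [Finset.prod_insert haS, mul_comm]

lemma cutWeight_insert_insert (s : F) (x : ι → F) {S K : Finset ι} {a : ι} (ha : a ∉ S)
    (hK : K ⊆ S) :
    cutWeight s x (insert a S) (insert a K) =
      cutWeight s x S K * ∏ j ∈ S \ K, pairWeight s x a j := by
  have haK : a ∉ K := fun h => ha (hK h)
  have hS : insert a S \ insert a K = S \ K := by grind
  simp only [cutWeight]
  rw [hS, Finset.prod_insert haK, mul_comm]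

lemma altCutSum_insert (s : F) (x : ι → F) {S : Finset ι} {a : ι} (ha : a ∉ S) :
    altCutSum s x (insert a S) = ∑ K ∈ S.powerset, (-1) ^ K.card * cutWeight s x S K *
      (∏ i ∈ K, pairWeight s x i a - ∏ j ∈ S \ K, pairWeight s x a j) := by
  rw [altCutSum, Finset.sum_powerset_insert ha, ← Finset.sum_add_distrib]
  refine Finset.sum_congr rfl fun K hK => ?_
  rw [Finset.mem_powerset] at hK
  have haK : a ∉ K := fun h => ha (hK h)
  rw [cutWeight_insert_left s x ha hK, cutWeight_insert_insert s x ha hK,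
    Finset.card_insert_of_notMem haK]
  ring

/-- The numerator, as a polynomial in the variable attached to an added index, of the contribution
of the subset `K` to the alternating cut sum of `S` with that index added. -/
noncomputable def cutNumerator (s : F) (x : ι → F) (S K : Finset ι) : Polynomial F :=
  (∏ i ∈ K, (.X ^ 2 - .C (s * x i) * .X - .C (x i ^ 2))) *
      ∏ j ∈ S \ K, (.X ^ 2 - .C (x j ^ 2)) -
    (∏ j ∈ S \ K, (.X ^ 2 + .C (s * x j) * .X - .C (x j ^ 2))) *
      ∏ i ∈ K, (.X ^ 2 - .C (x i ^ 2))

lemma eval_cutNumerator (s : F) (x : ι → F) (S K : Finset ι) (y : F) :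
    (cutNumerator s x S K).eval y =
      (∏ i ∈ K, (y ^ 2 - s * x i * y - x i ^ 2)) * ∏ j ∈ S \ K, (y ^ 2 - x j ^ 2) -
        (∏ j ∈ S \ K, (y ^ 2 + s * x j * y - x j ^ 2)) * ∏ i ∈ K, (y ^ 2 - x i ^ 2) := by
  simp [cutNumerator, Polynomial.eval_prod]

lemma natDegree_cutNumerator_le (s : F) (x : ι → F) {S K : Finset ι} (hK : K ⊆ S) :
    (cutNumerator s x S K).natDegree ≤ 2 * S.card := by
  have key : ∀ (T : Finset ι) (p : ι → Polynomial F), (∀ i, (p i).natDegree ≤ 2) →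
      (∏ i ∈ T, p i).natDegree ≤ 2 * T.card := fun T p hp =>
    (Polynomial.natDegree_prod_le T p).trans <| by
      rw [mul_comm, ← smul_eq_mul]
      exact Finset.sum_le_card_nsmul _ _ _ fun i _ => hp i
  have hcard := Finset.card_sdiff_add_card_eq_card hK
  refine (Polynomial.natDegree_sub_le _ _).trans (max_le ?_ ?_) <;>
    refine Polynomial.natDegree_mul_le.trans ?_
  · have h₁ := key K (fun i => .X ^ 2 - .C (s * x i) * .X - .C (x i ^ 2))
      fun i => by compute_degree
    have h₂ := key (S \ K) (fun j => .X ^ 2 - .C (x j ^ 2)) fun j => by compute_degree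
    lia
  · have h₁ := key (S \ K) (fun j => .X ^ 2 + .C (s * x j) * .X - .C (x j ^ 2))
      fun j => by compute_degree
    have h₂ := key K (fun i => .X ^ 2 - .C (x i ^ 2)) fun i => by compute_degree
    lia

/-- The numerator of the alternating cut sum of `S` with one index added, as a polynomial in the
variable attached to the added index. -/
noncomputable def altCutNumerator (s : F) (x : ι → F) (S : Finset ι) : Polynomial F :=
  ∑ K ∈ S.powerset, .C ((-1) ^ K.card * cutWeight s x S K) * cutNumerator s x S K

lemma eval_altCutNumerator (s : F) (x : ι → F) (S : Finset ι) (y : F) :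
    (altCutNumerator s x S).eval y =
      ∑ K ∈ S.powerset, (-1) ^ K.card * cutWeight s x S K * (cutNumerator s x S K).eval y := by
  simp [altCutNumerator, Polynomial.eval_finsetSum]

lemma natDegree_altCutNumerator_le (s : F) (x : ι → F) (S : Finset ι) :
    (altCutNumerator s x S).natDegree ≤ 2 * S.card :=
  Polynomial.natDegree_sum_le_of_forall_le _ _ fun _ hK =>
    (Polynomial.natDegree_C_mul_le _ _).trans
      (natDegree_cutNumerator_le s x (Finset.mem_powerset.1 hK))

lemma altCutSum_insert_mul_prod (s : F) (x : ι → F) {S : Finset ι} {a : ι} (ha : a ∉ S)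
    (hx : ∀ i ∈ S, x i ^ 2 ≠ x a ^ 2) :
    altCutSum s x (insert a S) * ∏ i ∈ S, (x a ^ 2 - x i ^ 2) =
      (altCutNumerator s x S).eval (x a) := by
  rw [altCutSum_insert s x ha, eval_altCutNumerator, Finset.sum_mul]
  refine Finset.sum_congr rfl fun K hK => ?_
  rw [Finset.mem_powerset] at hK
  rw [eval_cutNumerator, ← prod_pairWeight_mul_left s x fun i hi => hx i (hK hi),
    ← prod_pairWeight_mul_right s x fun i hi => hx i (Finset.mem_sdiff.1 hi).1,
    ← Finset.prod_sdiff hK]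
  ring

lemma eval_altCutNumerator_zero (s : F) (x : ι → F) (S : Finset ι) :
    (altCutNumerator s x S).eval 0 = 0 := by
  rw [eval_altCutNumerator]
  refine Finset.sum_eq_zero fun K _ => ?_
  rw [eval_cutNumerator]
  simp only [mul_zero, sub_zero, add_zero]
  ring

/-- The value of the numerator at a point `y = ± x k`, as a sum over the subsets avoiding `k`. -/
lemma eval_altCutNumerator_insert (s : F) (x : ι → F) {T : Finset ι} {k : ι} (hk : k ∉ T)
    (hx : ∀ i ∈ T, x i ^ 2 ≠ x k ^ 2) {y : F} (hy : y ^ 2 = x k ^ 2) :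
    (altCutNumerator s x (insert k T)).eval y =
      -(s * x k * y) * ∑ L ∈ T.powerset, (-1) ^ L.card * cutWeight s x T L *
        ((∏ i ∈ L, (x k ^ 2 - s * x i * x k - x i ^ 2)) *
            ∏ j ∈ T \ L, (x k ^ 2 + s * x j * y - x j ^ 2) -
          (∏ j ∈ T \ L, (x k ^ 2 + s * x j * x k - x j ^ 2)) *
            ∏ i ∈ L, (x k ^ 2 - s * x i * y - x i ^ 2)) := by
  rw [eval_altCutNumerator, Finset.sum_powerset_insert hk, ← Finset.sum_add_distrib,
    Finset.mul_sum]
  refine Finset.sum_congr rfl fun L hL => ?_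
  rw [Finset.mem_powerset] at hL
  have hkL : k ∉ L := fun h => hk (hL h)
  have hkT : k ∉ T \ L := fun h => hk (Finset.mem_sdiff.1 h).1
  have hS : insert k T \ insert k L = T \ L := by grind
  rw [cutWeight_insert_left s x hk hL, cutWeight_insert_insert s x hk hL,
    Finset.card_insert_of_notMem hkL, eval_cutNumerator, eval_cutNumerator, hS,
    Finset.insert_sdiff_of_notMem _ hkL]
  simp only [Finset.prod_insert hkL, Finset.prod_insert hkT, hy]
  rw [← prod_pairWeight_mul_left s x fun i hi => hx i (hL hi),
    ← prod_pairWeight_mul_right s x fun i hi => hx i (Finset.mem_sdiff.1 hi).1]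
  ring

lemma eval_altCutNumerator_insert_self (s : F) (x : ι → F) {T : Finset ι} {k : ι} (hk : k ∉ T)
    (hx : ∀ i ∈ T, x i ^ 2 ≠ x k ^ 2) :
    (altCutNumerator s x (insert k T)).eval (x k) = 0 := by
  rw [eval_altCutNumerator_insert s x hk hx rfl, Finset.sum_eq_zero, mul_zero]
  intro L _
  ring

/-- The residue at `-x k` is a multiple of the alternating cut sum without `k`. -/
lemma eval_altCutNumerator_insert_neg (s : F) (x : ι → F) {T : Finset ι} {k : ι} (hk : k ∉ T)
    (hx : ∀ i ∈ T, x i ^ 2 ≠ x k ^ 2) :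
    (altCutNumerator s x (insert k T)).eval (-x k) =
      s * x k ^ 2 * (altCutSum s x T *
        (∏ i ∈ T, (x k ^ 2 - s * x i * x k - x i ^ 2) -
          ∏ i ∈ T, (x k ^ 2 + s * x i * x k - x i ^ 2))) := by
  rw [eval_altCutNumerator_insert s x hk hx (neg_sq _), altCutSum, Finset.sum_mul]
  congr 1
  · ring
  refine Finset.sum_congr rfl fun L hL => ?_
  rw [Finset.mem_powerset] at hL
  simp only [mul_neg, ← sub_eq_add_neg, sub_neg_eq_add]
  rw [← Finset.prod_sdiff hL, ← Finset.prod_sdiff hL]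
  ring

/-- The alternating cut sum of an odd number of variables vanishes. -/
theorem altCutSum_eq_zero_of_odd [NeZero (2 : F)] (s : F) (x : ι → F) (S : Finset ι)
    (hS : Odd S.card) (h0 : ∀ i ∈ S, x i ≠ 0)
    (hx : ∀ i ∈ S, ∀ j ∈ S, i ≠ j → x i ^ 2 ≠ x j ^ 2) :
    altCutSum s x S = 0 := by
  induction S using Finset.strongInduction with
  | H S ih =>
  obtain ⟨a, haS⟩ : S.Nonempty := Finset.card_pos.1 hS.pos
  obtain ⟨S, ha, rfl⟩ : ∃ S', a ∉ S' ∧ insert a S' = S :=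
    ⟨S.erase a, Finset.notMem_erase a S, Finset.insert_erase haS⟩
  have hxS : ∀ i ∈ S, x i ^ 2 ≠ x a ^ 2 := fun i hi =>
    hx i (Finset.mem_insert_of_mem hi) a haS (ne_of_mem_of_not_mem hi ha)
  rw [Finset.card_insert_of_notMem ha] at hS
  have hself : ∀ k ∈ S, (altCutNumerator s x S).eval (x k) = 0 ∧
      (altCutNumerator s x S).eval (-x k) = 0 := by
    intro k hkS
    obtain ⟨T, hk, rfl⟩ : ∃ T, k ∉ T ∧ insert k T = S :=
      ⟨S.erase k, Finset.notMem_erase k S, Finset.insert_erase hkS⟩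
    have hsub : T ⊆ insert a (insert k T) :=
      (Finset.subset_insert k T).trans (Finset.subset_insert a _)
    have hxT : ∀ i ∈ T, x i ^ 2 ≠ x k ^ 2 := fun i hi =>
      hx i (hsub hi) k (Finset.mem_insert_of_mem hkS) (ne_of_mem_of_not_mem hi hk)
    rw [Finset.card_insert_of_notMem hk] at hS
    have hT : altCutSum s x T = 0 := by
      refine ih T ⟨hsub, fun h => ?_⟩ (by grind) (fun i hi => h0 i (hsub hi))
        fun i hi j hj => hx i (hsub hi) j (hsub hj)
      exact hk (h (Finset.mem_insert_of_mem hkS))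
    refine ⟨eval_altCutNumerator_insert_self s x hk hxT, ?_⟩
    rw [eval_altCutNumerator_insert_neg s x hk hxT, hT]
    ring
  have hinj : Set.InjOn x S := fun i hi j hj hij => by
    by_contra hne
    exact hx i (Finset.mem_insert_of_mem hi) j (Finset.mem_insert_of_mem hj) hne (by rw [hij])
  classical
  set R : Finset F := insert 0 (S.image x ∪ S.image fun i => -x i) with hR
  have hdisj : Disjoint (S.image x) (S.image fun i => -x i) := by
    rw [Finset.disjoint_left]
    intro y hy hy'
    obtain ⟨i, hi, rfl⟩ := Finset.mem_image.1 hy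
    obtain ⟨j, hj, hij⟩ := Finset.mem_image.1 hy'
    have hi0 := h0 i (Finset.mem_insert_of_mem hi)
    rcases eq_or_ne i j with rfl | hne
    · have h2 : 2 * x i = 0 := by linear_combination -hij
      exact (mul_ne_zero two_ne_zero hi0) h2
    · exact hx i (Finset.mem_insert_of_mem hi) j (Finset.mem_insert_of_mem hj) hne
        (by rw [← hij, neg_sq])
  have hzero : (0 : F) ∉ S.image x ∪ S.image fun i => -x i := by
    simp only [Finset.mem_union, Finset.mem_image, neg_eq_zero, not_or, not_exists, not_and]
    exact ⟨fun i hi => h0 i (Finset.mem_insert_of_mem hi),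
      fun i hi => h0 i (Finset.mem_insert_of_mem hi)⟩
  have hcard : R.card = 2 * S.card + 1 := by
    rw [hR, Finset.card_insert_of_notMem hzero, Finset.card_union_of_disjoint hdisj,
      Finset.card_image_of_injOn hinj,
      Finset.card_image_of_injOn fun i hi j hj hij => hinj hi hj (neg_injective hij)]
    ring
  have hnum : altCutNumerator s x S = 0 := by
    refine Polynomial.eq_zero_of_natDegree_lt_card_of_eval_eq_zero' _ R (fun y hy => ?_) ?_
    · rcases Finset.mem_insert.1 hy with rfl | hy
      · exact eval_altCutNumerator_zero s x S
      rcases Finset.mem_union.1 hy with hy | hy <;>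
        obtain ⟨k, hk, rfl⟩ := Finset.mem_image.1 hy
      exacts [(hself k hk).1, (hself k hk).2]
    · exact (natDegree_altCutNumerator_le s x S).trans_lt (by lia)
  have hprod : ∏ i ∈ S, (x a ^ 2 - x i ^ 2) ≠ 0 :=
    Finset.prod_ne_zero_iff.2 fun i hi => sub_ne_zero.2 (hxS i hi).symm
  have hmul := altCutSum_insert_mul_prod s x ha hxS
  rw [hnum, Polynomial.eval_zero] at hmul
  exact (mul_eq_zero.1 hmul).resolve_right hprod

end AlternatingCutSum

lemma ff_div_eq_pairWeight {ι : Type*} {ω : ℂ} (hω : ω ≠ 0) (x : ι → ℂ) {i j : ι}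
    (hj : x j ≠ 0) (hij : x i ^ 2 ≠ x j ^ 2) :
    ff ω (x i / x j) = pairWeight (ω - ω⁻¹) x i j := by
  have h := sub_ne_zero.2 hij
  have hd : (x i / x j) ^ 2 - 1 = (x i ^ 2 - x j ^ 2) / x j ^ 2 := by field_simp
  rw [ff, pairWeight, hd]
  field_simp
  ring

lemma phase_neg_half (N c : ℕ) :
    phase (-(1 / 2 : ℂ)) N c = Complex.exp (Real.pi * Complex.I * N / 2) * (-1) ^ c := by
  have hexp : Complex.I * (Real.pi : ℂ) * (-(1 / 2 : ℂ)) * (2 * (c : ℂ) - (N : ℂ)) =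
      Real.pi * Complex.I * N / 2 + c * (-(Real.pi * Complex.I)) := by ring
  rw [phase, hexp, Complex.exp_add, Complex.exp_nat_mul, Complex.exp_neg, Complex.exp_pi_mul_I]
  norm_num

/-- vanishing of the exponential-field `J` functions at the
free-fermion-like point `a = −1/2` for an odd number of particles: for odd `N` and
admissible `X`, `J_{N,−1/2}(X) = 0`. -/
theorem stmt18 (ω : ℂ) (hω : ω ≠ 0 ∧ ω ≠ 1 ∧ ω ≠ -1)
    (N : ℕ) (hN : Odd N) (X : Fin N → ℂ) (hadm : Admissible X) :
    Jexp ω (-(1 / 2 : ℂ)) X = 0 := by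
  obtain ⟨h0, hne⟩ := hadm
  have hsq : ∀ i j, i ≠ j → X i ^ 2 ≠ X j ^ 2 := fun i j hij h =>
    (sq_eq_sq_iff_eq_or_eq_neg.1 h).elim (hne i j hij).1 (hne i j hij).2
  have hsum : altCutSum (ω - ω⁻¹) X Finset.univ = 0 :=
    altCutSum_eq_zero_of_odd _ X _ (by simpa using hN) (fun i _ => h0 i)
      fun i _ j _ => hsq i j
  rw [altCutSum, Finset.powerset_univ] at hsum
  rw [Jexp, ← mul_zero (Complex.exp (Real.pi * Complex.I * N / 2)), ← hsum, Finset.mul_sum]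
  refine Finset.sum_congr rfl fun K _ => ?_
  rw [phase_neg_half, mul_assoc, cutWeight, ← Finset.compl_eq_univ_sdiff]
  congr 2
  refine Finset.prod_congr rfl fun i hi => Finset.prod_congr rfl fun j hj => ?_
  exact ff_div_eq_pairWeight hω.1 X (h0 j)
    (hsq i j fun h => Finset.mem_compl.1 hj (h ▸ hi))
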